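/- Let 2 ≤ k ≤ n be integers and let 0 ≤ l ≤ k−2. Then the function λ ↦ ( σ_{k−1}(λ)/σ_l(λ) )^{1/(k−1−l)} is concave on the Gårding cone Γ_{k−1}, and consequently the function λ ↦ σ_l(λ)/σ_{k−1}(λ) is convex on Γ_{k−1}. -/

import Mathlib

/-- The `m`-th elementary symmetric function of `λ = (λ_1, …, λ_n) ∈ ℝⁿ`. -/
def esymm (n m : ℕ) (lam : Fin n → ℝ) : ℝ :=
  ∑ s ∈ (Finset.univ : Finset (Fin n)).powersetCard m, ∏ i ∈ s, lam i

/-- The Gårding cone `Γ_m = {λ ∈ ℝⁿ : σ_j(λ) > 0 for all 1 ≤ j ≤ m}`. -/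
def GardingCone (n m : ℕ) : Set (Fin n → ℝ) :=
  {lam | ∀ j : ℕ, 1 ≤ j → j ≤ m → 0 < esymm n j lam}

/-- The `m`-th elementary symmetric function of the variables indexed by the finite set `s`. -/
def esymmOn {ι : Type*} (s : Finset ι) (m : ℕ) (x : ι → ℝ) : ℝ :=
  ∑ t ∈ s.powersetCard m, ∏ i ∈ t, x i

/-- The Gårding cone for the variables indexed by the finite set `s`. -/
def gardingConeOn {ι : Type*} (s : Finset ι) (m : ℕ) : Set (ι → ℝ) :=
  {x | ∀ j : ℕ, 1 ≤ j → j ≤ m → 0 < esymmOn s j x}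

section Newton

open Polynomial

/-- The derivative of a real-rooted polynomial is real-rooted. -/
lemma Polynomial.Splits.derivative_real {p : ℝ[X]} (hp : p.Splits) : (derivative p).Splits := by
  by_cases h0 : p.natDegree = 0
  · rw [derivative_of_natDegree_zero h0]
    exact Splits.zero
  rw [splits_iff_card_roots] at hp ⊢
  have h1 := card_roots_le_derivative p
  have h2 := card_roots' (derivative p)
  have h3 := natDegree_derivative_lt h0
  omega

lemma Polynomial.Splits.iterate_derivative_real {p : ℝ[X]} (hp : p.Splits) (k : ℕ) :
    (derivative^[k] p).Splits := by
  induction k with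
  | zero => exact hp
  | succ k ih =>
    rw [Function.iterate_succ_apply']
    exact ih.derivative_real

/-- Laguerre's inequality for real-rooted polynomials. -/
lemma Polynomial.Splits.eval_mul_eval_derivative_derivative_le {p : ℝ[X]} (hp : p.Splits) (x : ℝ) :
    p.eval x * (derivative (derivative p)).eval x ≤ ((derivative p).eval x) ^ 2 := by
  rw [hp.eq_prod_roots]
  generalize p.leadingCoeff = c
  induction p.roots using Multiset.induction_on with
  | empty => simp
  | cons r m ih =>
    simp only [Multiset.map_cons, Multiset.prod_cons]
    generalize (Multiset.map (fun x => X - C x) m).prod = q at ih ⊢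
    simp only [derivative_mul, derivative_add, derivative_sub, derivative_X, derivative_C, eval_mul,
      eval_add, eval_sub, eval_X, eval_C, derivative_zero, derivative_one, eval_zero,
      eval_one] at ih ⊢
    nlinarith [mul_le_mul_of_nonneg_left ih (sq_nonneg (x - r)), sq_nonneg (c * eval x q)]

/-- Newton's inequality (without the binomial factor) for coefficients of real-rooted
polynomials. -/
lemma Polynomial.Splits.coeff_mul_coeff_le {p : ℝ[X]} (hp : p.Splits) (j : ℕ) :
    p.coeff j * p.coeff (j + 2) ≤ p.coeff (j + 1) ^ 2 := by
  have h := (hp.iterate_derivative_real j).eval_mul_eval_derivative_derivative_le 0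
  rw [← Function.iterate_succ_apply' derivative, ← Function.iterate_succ_apply' derivative,
    ← coeff_zero_eq_eval_zero, ← coeff_zero_eq_eval_zero, ← coeff_zero_eq_eval_zero] at h
  simp only [coeff_iterate_derivative, zero_add, Nat.descFactorial_self, nsmul_eq_mul,
    Nat.succ_eq_add_one, Nat.factorial_succ, Nat.cast_mul] at h
  push_cast at h
  have hf : (0 : ℝ) < (j.factorial : ℝ) ^ 2 * (j + 1) := by positivity
  have h' : (j.factorial : ℝ) ^ 2 * (j + 1) * ((j + 2) * (p.coeff j * p.coeff (j + 2))) ≤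
      (j.factorial : ℝ) ^ 2 * (j + 1) * ((j + 1) * p.coeff (j + 1) ^ 2) := by
    linarith
  have h2 := le_of_mul_le_mul_left h' hf
  by_contra! hlt
  nlinarith [sq_nonneg (p.coeff (j + 1)), mul_lt_mul_of_pos_left hlt (by positivity : (0:ℝ) < j + 1)]

end Newton

section ElementarySymmetric

variable {ι : Type*}

lemma esymmOn_zero (s : Finset ι) (x : ι → ℝ) : esymmOn s 0 x = 1 := by
  simp [esymmOn]

lemma esymmOn_one (s : Finset ι) (x : ι → ℝ) : esymmOn s 1 x = ∑ i ∈ s, x i := by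
  simp [esymmOn, Finset.powersetCard_one]

lemma esymmOn_smul (s : Finset ι) (m : ℕ) (a : ℝ) (x : ι → ℝ) :
    esymmOn s m (a • x) = a ^ m * esymmOn s m x := by
  simp only [esymmOn, Finset.mul_sum]
  refine Finset.sum_congr rfl fun t ht => ?_
  simp [Finset.prod_mul_distrib, (Finset.mem_powersetCard.1 ht).2]

lemma esymmOn_insert [DecidableEq ι] {s : Finset ι} {i : ι} (hi : i ∉ s) (m : ℕ) (x : ι → ℝ) :
    esymmOn (insert i s) (m + 1) x = esymmOn s (m + 1) x + x i * esymmOn s m x := by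
  have hmem : ∀ t ∈ s.powersetCard m, i ∉ t := fun t ht hit =>
    hi ((Finset.mem_powersetCard.1 ht).1 hit)
  unfold esymmOn
  rw [Finset.powersetCard_succ_insert hi, Finset.sum_union, Finset.sum_image, Finset.mul_sum]
  · congr 1
    exact Finset.sum_congr rfl fun t ht => Finset.prod_insert (hmem t ht)
  · intro t ht u hu htu
    rw [← Finset.erase_insert (hmem t ht), ← Finset.erase_insert (hmem u hu)]
    exact congrArg (fun v => v.erase i) htu
  · refine Finset.disjoint_left.2 fun t ht ht' => ?_
    obtain ⟨u, -, rfl⟩ := Finset.mem_image.1 ht'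
    exact hi ((Finset.mem_powersetCard.1 ht).1 (Finset.mem_insert_self _ _))

lemma esymmOn_erase [DecidableEq ι] {s : Finset ι} {i : ι} (hi : i ∈ s) (m : ℕ) (x : ι → ℝ) :
    esymmOn s (m + 1) x = esymmOn (s.erase i) (m + 1) x + x i * esymmOn (s.erase i) m x := by
  rw [← esymmOn_insert (Finset.notMem_erase i s), Finset.insert_erase hi]

lemma sum_mul_esymmOn_erase [DecidableEq ι] (s : Finset ι) (m : ℕ) (x : ι → ℝ) :
    ∑ i ∈ s, x i * esymmOn (s.erase i) m x = (m + 1) * esymmOn s (m + 1) x := by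
  induction s using Finset.induction_on generalizing m with
  | empty =>
    have : (∅ : Finset ι).powersetCard (m + 1) = ∅ :=
      Finset.powersetCard_eq_empty.2 (by simp)
    simp [esymmOn, this]
  | insert a s ha ih =>
    cases m with
    | zero => simp [esymmOn_zero, esymmOn_one]
    | succ m =>
      have key : ∀ i ∈ s, x i * esymmOn ((insert a s).erase i) (m + 1) x =
          x i * esymmOn (s.erase i) (m + 1) x + x a * (x i * esymmOn (s.erase i) m x) := by
        intro i hi
        have hia : a ≠ i := fun h => ha (h ▸ hi)
        rw [Finset.erase_insert_of_ne hia,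
          esymmOn_insert (fun h => ha (Finset.mem_of_mem_erase h))]
        ring
      rw [Finset.sum_insert ha, Finset.erase_insert ha, Finset.sum_congr rfl key,
        Finset.sum_add_distrib, ← Finset.mul_sum, ih, ih, esymmOn_insert ha]
      push_cast
      ring

lemma esymmOn_mul_esymmOn_le (s : Finset ι) (m : ℕ) (x : ι → ℝ) :
    esymmOn s m x * esymmOn s (m + 2) x ≤ esymmOn s (m + 1) x ^ 2 := by
  by_cases h : m + 2 ≤ s.card
  · have hp : (∏ i ∈ s, (Polynomial.X + Polynomial.C (x i))).Splits :=
      Polynomial.Splits.prod fun i _ => Polynomial.Splits.X_add_C _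
    have hN := hp.coeff_mul_coeff_le (s.card - (m + 2))
    rw [Finset.prod_X_add_C_coeff _ _ (by omega), Finset.prod_X_add_C_coeff _ _ (by omega),
      Finset.prod_X_add_C_coeff _ _ (by omega),
      show s.card - (s.card - (m + 2)) = m + 2 by omega,
      show s.card - (s.card - (m + 2) + 2) = m by omega,
      show s.card - (s.card - (m + 2) + 1) = m + 1 by omega] at hN
    rw [mul_comm]
    exact hN
  · have : s.powersetCard (m + 2) = ∅ := Finset.powersetCard_eq_empty.2 (by omega)
    have h0 : esymmOn s (m + 2) x = 0 := by simp [esymmOn, this]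
    rw [h0, mul_zero]
    positivity

lemma gardingConeOn_anti (s : Finset ι) {m m' : ℕ} (h : m ≤ m') :
    gardingConeOn s m' ⊆ gardingConeOn s m :=
  fun _ hx j hj hjm => hx j hj (hjm.trans h)

lemma esymmOn_pos {s : Finset ι} {m j : ℕ} {x : ι → ℝ} (hx : x ∈ gardingConeOn s m)
    (hj : j ≤ m) : 0 < esymmOn s j x := by
  rcases Nat.eq_zero_or_pos j with rfl | h
  · rw [esymmOn_zero]
    exact one_pos
  · exact hx j h hj

lemma mem_gardingConeOn_succ {s : Finset ι} {m : ℕ} {x : ι → ℝ} :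
    x ∈ gardingConeOn s (m + 1) ↔ x ∈ gardingConeOn s m ∧ 0 < esymmOn s (m + 1) x := by
  refine ⟨fun h => ⟨gardingConeOn_anti s m.le_succ h, esymmOn_pos h le_rfl⟩, fun h j hj hjm => ?_⟩
  rcases Nat.lt_or_eq_of_le hjm with hlt | rfl
  · exact h.1 j hj (by omega)
  · exact h.2

lemma smul_mem_gardingConeOn {s : Finset ι} {m : ℕ} {x : ι → ℝ} (hx : x ∈ gardingConeOn s m)
    {a : ℝ} (ha : 0 < a) : a • x ∈ gardingConeOn s m := by
  intro j hj hjm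
  rw [esymmOn_smul]
  exact mul_pos (pow_pos ha j) (hx j hj hjm)

/-- Deleting a variable maps the Gårding cone of order `m + 1` to the one of order `m`. -/
lemma mem_gardingConeOn_erase [DecidableEq ι] {s : Finset ι} {m : ℕ} {x : ι → ℝ}
    (hx : x ∈ gardingConeOn s (m + 1)) {i : ι} (hi : i ∈ s) :
    x ∈ gardingConeOn (s.erase i) m := by
  induction m with
  | zero => exact fun j hj hj0 => by omega
  | succ m ih =>
    have hy := ih (gardingConeOn_anti s (Nat.le_succ _) hx)
    refine mem_gardingConeOn_succ.2 ⟨hy, ?_⟩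
    have h0 := esymmOn_pos hy le_rfl
    have h1 := esymmOn_pos hx (Nat.le_succ (m + 1))
    have h2 := esymmOn_pos hx le_rfl
    rw [esymmOn_erase hi] at h1 h2
    have hN := esymmOn_mul_esymmOn_le (s.erase i) m x
    by_contra! hneg
    have h3 : 0 < esymmOn (s.erase i) (m + 2) x + x i * esymmOn (s.erase i) (m + 1) x := h2
    nlinarith [mul_pos h0 h3, mul_nonneg (neg_nonneg.2 hneg) h1.le]

/-- The quotient of consecutive elementary symmetric functions as a function of the same quotients
with one variable deleted. -/
lemma esymmOn_div_esymmOn [DecidableEq ι] {s : Finset ι} {m : ℕ} {x : ι → ℝ}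
    (h : esymmOn s (m + 1) x ≠ 0) (he : ∀ i ∈ s, esymmOn (s.erase i) m x ≠ 0) :
    esymmOn s (m + 2) x / esymmOn s (m + 1) x = ((m : ℝ) + 2)⁻¹ *
      ∑ i ∈ s, (x i - x i ^ 2 /
        (x i + esymmOn (s.erase i) (m + 1) x / esymmOn (s.erase i) m x)) := by
  have key : ∀ i ∈ s, x i - x i ^ 2 /
        (x i + esymmOn (s.erase i) (m + 1) x / esymmOn (s.erase i) m x) =
      x i * esymmOn (s.erase i) (m + 1) x / esymmOn s (m + 1) x := by
    intro i hi
    have h1 := he i hi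
    rw [esymmOn_erase hi] at h ⊢
    have h2 : x i + esymmOn (s.erase i) (m + 1) x / esymmOn (s.erase i) m x =
        (esymmOn (s.erase i) (m + 1) x + x i * esymmOn (s.erase i) m x) /
          esymmOn (s.erase i) m x := by
      field_simp
      ring
    rw [h2]
    field_simp
    ring
  rw [Finset.sum_congr rfl key, ← Finset.sum_div, sum_mul_esymmOn_erase]
  push_cast
  have : (m : ℝ) + 2 ≠ 0 := by positivity
  have h' : (m : ℝ) + 1 + 1 = m + 2 := by ring
  rw [h', ← mul_div_assoc, inv_mul_cancel_left₀ this]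

lemma sub_sq_div_superadditive {a₁ a₂ b₁ b₂ b : ℝ} (h₁ : 0 < a₁ + b₁) (h₂ : 0 < a₂ + b₂)
    (hb : b₁ + b₂ ≤ b) :
    (a₁ - a₁ ^ 2 / (a₁ + b₁)) + (a₂ - a₂ ^ 2 / (a₂ + b₂)) ≤
      (a₁ + a₂) - (a₁ + a₂) ^ 2 / (a₁ + a₂ + b) := by
  have h3 : (a₁ + a₂) ^ 2 / (a₁ + a₂ + b) ≤ (a₁ + a₂) ^ 2 / ((a₁ + b₁) + (a₂ + b₂)) :=
    div_le_div_of_nonneg_left (sq_nonneg _) (by linarith) (by linarith)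
  have h4 : (a₁ + a₂) ^ 2 / ((a₁ + b₁) + (a₂ + b₂)) ≤
      a₁ ^ 2 / (a₁ + b₁) + a₂ ^ 2 / (a₂ + b₂) := by
    generalize a₁ + b₁ = t₁ at *
    generalize a₂ + b₂ = t₂ at *
    rw [div_add_div _ _ h₁.ne' h₂.ne', div_le_div_iff₀ (by linarith) (by positivity)]
    nlinarith [sq_nonneg (a₁ * t₂ - a₂ * t₁)]
  linarith

/-- The Gårding cone is closed under addition, and quotients of consecutive elementary symmetric
functions are superadditive on it. -/
lemma gardingConeOn_superadditive [DecidableEq ι] (m : ℕ) (s : Finset ι) {x y : ι → ℝ}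
    (hx : x ∈ gardingConeOn s (m + 1)) (hy : y ∈ gardingConeOn s (m + 1)) :
    x + y ∈ gardingConeOn s (m + 1) ∧
      esymmOn s (m + 1) x / esymmOn s m x + esymmOn s (m + 1) y / esymmOn s m y ≤
        esymmOn s (m + 1) (x + y) / esymmOn s m (x + y) := by
  induction m generalizing s with
  | zero =>
    have h1 : esymmOn s 1 (x + y) = esymmOn s 1 x + esymmOn s 1 y := by
      simp [esymmOn_one, Finset.sum_add_distrib]
    refine ⟨fun j hj hj1 => ?_, ?_⟩
    · obtain rfl : j = 1 := by omega
      rw [h1]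
      exact add_pos (hx 1 le_rfl le_rfl) (hy 1 le_rfl le_rfl)
    · simp [esymmOn_zero, h1]
  | succ m ih =>
    obtain ⟨hxy, -⟩ := ih s (gardingConeOn_anti s (Nat.le_succ _) hx)
      (gardingConeOn_anti s (Nat.le_succ _) hy)
    have her : ∀ i ∈ s, _ := fun i hi =>
      ih (s.erase i) (mem_gardingConeOn_erase hx hi) (mem_gardingConeOn_erase hy hi)
    have hpos : ∀ z ∈ gardingConeOn s (m + 2), ∀ i ∈ s,
        0 < z i + esymmOn (s.erase i) (m + 1) z / esymmOn (s.erase i) m z := by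
      intro z hz i hi
      have h0 := esymmOn_pos (mem_gardingConeOn_erase hz hi) m.le_succ
      have h1 := esymmOn_pos hz (Nat.le_succ (m + 1))
      rw [esymmOn_erase hi] at h1
      have h2 : z i + esymmOn (s.erase i) (m + 1) z / esymmOn (s.erase i) m z =
          (esymmOn (s.erase i) (m + 1) z + z i * esymmOn (s.erase i) m z) /
            esymmOn (s.erase i) m z := by
        field_simp
        ring
      rw [h2]
      exact div_pos h1 h0
    have hsum : esymmOn s (m + 2) x / esymmOn s (m + 1) x +
        esymmOn s (m + 2) y / esymmOn s (m + 1) y ≤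
          esymmOn s (m + 2) (x + y) / esymmOn s (m + 1) (x + y) := by
      rw [esymmOn_div_esymmOn (esymmOn_pos hx (Nat.le_succ _)).ne'
          fun i hi => (esymmOn_pos (mem_gardingConeOn_erase hx hi) m.le_succ).ne',
        esymmOn_div_esymmOn (esymmOn_pos hy (Nat.le_succ _)).ne'
          fun i hi => (esymmOn_pos (mem_gardingConeOn_erase hy hi) m.le_succ).ne',
        esymmOn_div_esymmOn (esymmOn_pos hxy le_rfl).ne'
          fun i hi => (esymmOn_pos (her i hi).1 m.le_succ).ne',
        ← mul_add, ← Finset.sum_add_distrib]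
      refine mul_le_mul_of_nonneg_left (Finset.sum_le_sum fun i hi => ?_) (by positivity)
      exact sub_sq_div_superadditive (hpos x hx i hi) (hpos y hy i hi) (her i hi).2
    refine ⟨mem_gardingConeOn_succ.2 ⟨hxy, ?_⟩, hsum⟩
    have hx' := div_pos (esymmOn_pos hx le_rfl) (esymmOn_pos hx (Nat.le_succ _))
    have hy' := div_pos (esymmOn_pos hy le_rfl) (esymmOn_pos hy (Nat.le_succ _))
    exact (div_pos_iff_of_pos_right (esymmOn_pos hxy le_rfl)).1 ((add_pos hx' hy').trans_le hsum)

lemma add_mem_gardingConeOn {s : Finset ι} {m : ℕ} {x y : ι → ℝ}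
    (hx : x ∈ gardingConeOn s m) (hy : y ∈ gardingConeOn s m) : x + y ∈ gardingConeOn s m := by
  classical
  cases m with
  | zero => exact fun j hj hj0 => by omega
  | succ m => exact (gardingConeOn_superadditive m s hx hy).1

lemma convex_gardingConeOn (s : Finset ι) (m : ℕ) : Convex ℝ (gardingConeOn s m) :=
  convex_iff_forall_pos.2 fun _ hx _ hy _ _ ha hb _ =>
    add_mem_gardingConeOn (smul_mem_gardingConeOn hx ha) (smul_mem_gardingConeOn hy hb)

/-- The geometric mean is superadditive. -/
lemma prod_rpow_add_le {κ : Type*} (t : Finset κ) (ht : t.Nonempty) {u v : κ → ℝ}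
    (hu : ∀ i ∈ t, 0 < u i) (hv : ∀ i ∈ t, 0 < v i) :
    (∏ i ∈ t, u i) ^ (1 / (t.card : ℝ)) + (∏ i ∈ t, v i) ^ (1 / (t.card : ℝ)) ≤
      (∏ i ∈ t, (u i + v i)) ^ (1 / (t.card : ℝ)) := by
  have hc : (0 : ℝ) < t.card := by exact_mod_cast ht.card_pos
  have hw : ∑ _i ∈ t, 1 / (t.card : ℝ) = 1 := by
    rw [Finset.sum_const, nsmul_eq_mul]
    field_simp
  have huv : ∀ i ∈ t, 0 < u i + v i := fun i hi => add_pos (hu i hi) (hv i hi)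
  have amgm : ∀ f : κ → ℝ, (∀ i ∈ t, 0 < f i) →
      (∏ i ∈ t, f i) ^ (1 / (t.card : ℝ)) / (∏ i ∈ t, (u i + v i)) ^ (1 / (t.card : ℝ)) ≤
        ∑ i ∈ t, 1 / (t.card : ℝ) * (f i / (u i + v i)) := by
    intro f hf
    have hq : ∀ i ∈ t, 0 ≤ f i / (u i + v i) := fun i hi => (div_pos (hf i hi) (huv i hi)).le
    rw [← Real.div_rpow (Finset.prod_nonneg fun i hi => (hf i hi).le)
      (Finset.prod_nonneg fun i hi => (huv i hi).le), ← Finset.prod_div_distrib,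
      ← Real.finsetProd_rpow t _ hq]
    exact Real.geom_mean_le_arith_mean_weighted t _ _ (fun _ _ => by positivity) hw hq
  have h := add_le_add (amgm u hu) (amgm v hv)
  rw [← Finset.sum_add_distrib, ← add_div] at h
  have h1 : ∑ i ∈ t, (1 / (t.card : ℝ) * (u i / (u i + v i)) +
      1 / (t.card : ℝ) * (v i / (u i + v i))) = 1 := by
    refine (Finset.sum_congr rfl fun i hi => ?_).trans hw
    rw [← mul_add, ← add_div, div_self (huv i hi).ne', mul_one]
  rwa [h1, div_le_one (Real.rpow_pos_of_pos (Finset.prod_pos huv) _)] at h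

lemma prod_esymmOn_div {s : Finset ι} {x : ι → ℝ} (l N : ℕ) (hx : x ∈ gardingConeOn s (l + N)) :
    ∏ j ∈ Finset.range N, esymmOn s (l + j + 1) x / esymmOn s (l + j) x =
      esymmOn s (l + N) x / esymmOn s l x := by
  induction N with
  | zero => simp [div_self (esymmOn_pos hx (Nat.le_refl l)).ne']
  | succ N ih =>
    have h := gardingConeOn_anti s (by omega : l + N ≤ l + (N + 1)) hx
    rw [Finset.prod_range_succ, ih h, mul_comm, div_mul_div_cancel₀ (esymmOn_pos h le_rfl).ne']
    rfl

lemma superadditive_rpow_esymmOn_div {s : Finset ι} {l N : ℕ} (hN : 0 < N) {x y : ι → ℝ}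
    (hx : x ∈ gardingConeOn s (l + N)) (hy : y ∈ gardingConeOn s (l + N)) :
    (esymmOn s (l + N) x / esymmOn s l x) ^ (1 / (N : ℝ)) +
        (esymmOn s (l + N) y / esymmOn s l y) ^ (1 / (N : ℝ)) ≤
      (esymmOn s (l + N) (x + y) / esymmOn s l (x + y)) ^ (1 / (N : ℝ)) := by
  classical
  have hpos : ∀ z ∈ gardingConeOn s (l + N), ∀ j ∈ Finset.range N,
      0 < esymmOn s (l + j + 1) z / esymmOn s (l + j) z := by
    intro z hz j hj
    have := Finset.mem_range.1 hj
    exact div_pos (esymmOn_pos hz (by omega)) (esymmOn_pos hz (by omega))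
  have h := prod_rpow_add_le (Finset.range N) (Finset.nonempty_range_iff.2 hN.ne')
    (hpos x hx) (hpos y hy)
  rw [Finset.card_range] at h
  rw [← prod_esymmOn_div l N hx, ← prod_esymmOn_div l N hy,
    ← prod_esymmOn_div l N (add_mem_gardingConeOn hx hy)]
  refine h.trans (Real.rpow_le_rpow (Finset.prod_nonneg fun j hj =>
    (add_pos (hpos x hx j hj) (hpos y hy j hj)).le) ?_ (by positivity))
  refine Finset.prod_le_prod (fun j hj => (add_pos (hpos x hx j hj) (hpos y hy j hj)).le)
    fun j hj => ?_
  have hj' : l + j + 1 ≤ l + N := by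
    have := Finset.mem_range.1 hj
    omega
  exact (gardingConeOn_superadditive (l + j) s (gardingConeOn_anti s hj' hx)
    (gardingConeOn_anti s hj' hy)).2

lemma rpow_esymmOn_div_smul {s : Finset ι} {l N : ℕ} (hN : 0 < N) {x : ι → ℝ}
    (hx : x ∈ gardingConeOn s (l + N)) {a : ℝ} (ha : 0 < a) :
    (esymmOn s (l + N) (a • x) / esymmOn s l (a • x)) ^ (1 / (N : ℝ)) =
      a * (esymmOn s (l + N) x / esymmOn s l x) ^ (1 / (N : ℝ)) := by
  have h0 := esymmOn_pos hx (Nat.le_add_right l N)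
  have h1 := esymmOn_pos hx le_rfl
  have h2 : esymmOn s (l + N) (a • x) / esymmOn s l (a • x) =
      a ^ N * (esymmOn s (l + N) x / esymmOn s l x) := by
    rw [esymmOn_smul, esymmOn_smul, pow_add]
    field_simp
  rw [h2, Real.mul_rpow (by positivity) (by positivity), one_div,
    Real.pow_rpow_inv_natCast ha.le hN.ne']

theorem concaveOn_rpow_esymmOn_div (s : Finset ι) (l : ℕ) {N : ℕ} (hN : 0 < N) :
    ConcaveOn ℝ (gardingConeOn s (l + N))
      (fun x => (esymmOn s (l + N) x / esymmOn s l x) ^ (1 / (N : ℝ))) := by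
  refine concaveOn_iff_forall_pos.2 ⟨convex_gardingConeOn s _, fun x hx y hy a b ha hb _ => ?_⟩
  have h := superadditive_rpow_esymmOn_div hN (smul_mem_gardingConeOn hx ha)
    (smul_mem_gardingConeOn hy hb)
  rwa [rpow_esymmOn_div_smul hN hx ha, rpow_esymmOn_div_smul hN hy hb] at h

theorem convexOn_esymmOn_div (s : Finset ι) (l : ℕ) {N : ℕ} (hN : 0 < N) :
    ConvexOn ℝ (gardingConeOn s (l + N)) (fun x => esymmOn s l x / esymmOn s (l + N) x) := by
  obtain ⟨hconv, hconc⟩ := concaveOn_rpow_esymmOn_div s l hN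
  refine ⟨hconv, fun x hx y hy a b ha hb hab => ?_⟩
  have hq : ∀ z ∈ gardingConeOn s (l + N), 0 < esymmOn s (l + N) z / esymmOn s l z := fun z hz =>
    div_pos (esymmOn_pos hz le_rfl) (esymmOn_pos hz (Nat.le_add_right l N))
  have hf : ∀ z ∈ gardingConeOn s (l + N),
      0 < (esymmOn s (l + N) z / esymmOn s l z) ^ (1 / (N : ℝ)) := fun z hz =>
    Real.rpow_pos_of_pos (hq z hz) _
  have heq : ∀ z ∈ gardingConeOn s (l + N), esymmOn s l z / esymmOn s (l + N) z =
      ((esymmOn s (l + N) z / esymmOn s l z) ^ (1 / (N : ℝ))) ^ (-(N : ℤ)) := by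
    intro z hz
    rw [zpow_neg, zpow_natCast, one_div, Real.rpow_inv_natCast_pow (hq z hz).le hN.ne', inv_div]
  have hz := hconv hx hy ha hb hab
  have hle := hconc hx hy ha hb hab
  have hpos : 0 < a • (esymmOn s (l + N) x / esymmOn s l x) ^ (1 / (N : ℝ)) +
      b • (esymmOn s (l + N) y / esymmOn s l y) ^ (1 / (N : ℝ)) :=
    convex_Ioi (0 : ℝ) (hf x hx) (hf y hy) ha hb hab
  have h := (convexOn_zpow (𝕜 := ℝ) (-(N : ℤ))).2 (hf x hx) (hf y hy) ha hb hab
  simp only [heq x hx, heq y hy, heq _ hz]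
  refine le_trans ?_ h
  simp only [zpow_neg, zpow_natCast]
  exact inv_anti₀ (pow_pos hpos N) (pow_le_pow_left₀ hpos.le hle N)

end ElementarySymmetric

/-- For `2 ≤ k ≤ n` and `0 ≤ l ≤ k-2`, the function
`λ ↦ (σ_{k-1}(λ)/σ_l(λ))^{1/(k-1-l)}` is concave on `Γ_{k-1}`, and consequently
`λ ↦ σ_l(λ)/σ_{k-1}(λ)` is convex on `Γ_{k-1}`. -/
theorem quotient_power_concave_and_quotient_convex (n k l : ℕ) (hk : 2 ≤ k)
    (hkn : k ≤ n) (hl : l ≤ k - 2) :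
    ConcaveOn ℝ (GardingCone n (k - 1))
        (fun lam =>
          (esymm n (k - 1) lam / esymm n l lam) ^
            ((1 : ℝ) / ((k : ℝ) - 1 - (l : ℝ)))) ∧
      ConvexOn ℝ (GardingCone n (k - 1))
        (fun lam => esymm n l lam / esymm n (k - 1) lam) := by
  obtain ⟨N, hN, rfl⟩ : ∃ N, 0 < N ∧ k = l + N + 1 := ⟨k - 1 - l, by omega, by omega⟩
  have hexp : ((l + N + 1 : ℕ) : ℝ) - 1 - (l : ℝ) = N := by
    push_cast
    ring
  rw [hexp]
  exact ⟨concaveOn_rpow_esymmOn_div Finset.univ l hN, convexOn_esymmOn_div Finset.univ l hN⟩
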